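/- arXiv:2311.01706 — 8 statements merged into one kernel-verified Lean document; each statement's English description precedes it below -/
import Mathlib

section
/- Let R be a commutative Noetherian ring, M a finitely generated R-module, and N a proper submodule of M. If N = M_0 ⊂ M_1 ⊂ ⋯ ⊂ M_n = M is a regular prime extension filtration of M over N with prime ideals p_1, …, p_n (so that M_i is a regular p_i-prime extension of M_{i-1} in M for each i), then for every 1 ≤ i ≤ n the set of associated primes of M/M_{i-1} equals {p_i, p_{i+1}, …, p_n}. In particular, Ass_R(M/N) = {p_1, …, p_n}. -/
open Submodule

section Defs

variable {R : Type*} [CommRing R] {M : Type*} [AddCommGroup M] [Module R M]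

/-- `K` is a `p`-prime extension of `N` (i.e. `N` is a `p`-prime submodule of `K`):
`(N : K) = p` and for all `a : R`, `x ∈ K`, `a • x ∈ N` implies `a ∈ p` or `x ∈ N`. -/
def IsPrimeExtension (p : Ideal R) (N K : Submodule R M) : Prop :=
  p.IsPrime ∧ N ≤ K ∧ N.colon K = p ∧
    ∀ (a : R) (x : M), x ∈ K → a • x ∈ N → a ∈ p ∨ x ∈ N

/-- `K` is a maximal `p`-prime extension of `N` in the ambient module: no `p`-prime
extension of `N` properly contains `K`. -/
def IsMaximalPrimeExtension (p : Ideal R) (N K : Submodule R M) : Prop :=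
  IsPrimeExtension p N K ∧ ∀ L : Submodule R M, IsPrimeExtension p N L → ¬ K < L

/-- `K` is a regular `p`-prime extension of `N` in the ambient module: `K` is a maximal
`p`-prime extension of `N` and `p` is a maximal element of `Ass(M/N)`. -/
def IsRegularPrimeExtension (p : Ideal R) (N K : Submodule R M) : Prop :=
  IsMaximalPrimeExtension p N K ∧ p ∈ associatedPrimes R (M ⧸ N) ∧
    ∀ q ∈ associatedPrimes R (M ⧸ N), p ≤ q → q = p

/-- `F 0 = N ⊂ F 1 ⊂ ⋯ ⊂ F n = M` is a regular prime extension (RPE) filtration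
of the ambient module over `N`, with prime ideals `p 0, …, p (n-1)`. -/
def IsRPEFiltration (N : Submodule R M) (n : ℕ) (F : Fin (n + 1) → Submodule R M)
    (p : Fin n → Ideal R) : Prop :=
  F 0 = N ∧ F (Fin.last n) = ⊤ ∧
    ∀ i : Fin n, IsRegularPrimeExtension (p i) (F i.castSucc) (F i.succ)

/-- `N` has generalized prime ideal factorization given by the multiset `S` of primes. -/
def HasPFactorization (N : Submodule R M) (S : Multiset (Ideal R)) : Prop :=
  ∃ (n : ℕ) (F : Fin (n + 1) → Submodule R M) (p : Fin n → Ideal R),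
    IsRPEFiltration N n F p ∧ (List.ofFn p : Multiset (Ideal R)) = S

end Defs

section AssociatedPrimes

variable {R : Type*} [CommRing R] {M : Type*} [AddCommGroup M] [Module R M]

theorem mem_associatedPrimes_quotient_iff [IsNoetherianRing R] {N : Submodule R M}
    {q : Ideal R} :
    q ∈ associatedPrimes R (M ⧸ N) ↔ q.IsPrime ∧ ∃ x : M, ∀ a : R, a ∈ q ↔ a • x ∈ N := by
  rw [AssociatedPrimes.mem_iff, isAssociatedPrime_iff]
  refine and_congr_right fun _ => ⟨?_, ?_⟩
  · rintro ⟨y, hy⟩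
    obtain ⟨x, rfl⟩ := N.mkQ_surjective y
    refine ⟨x, fun a => ?_⟩
    rw [hy, mem_colon_singleton, ← map_smul, mem_bot, mkQ_apply, Quotient.mk_eq_zero]
  · rintro ⟨x, hx⟩
    refine ⟨N.mkQ x, Ideal.ext fun a => ?_⟩
    rw [hx, mem_colon_singleton, ← map_smul, mem_bot, mkQ_apply, Quotient.mk_eq_zero]

theorem exists_mem_associatedPrimes_quotient_of_notMem [IsNoetherianRing R]
    {N : Submodule R M} {x : M} (hx : x ∉ N) :
    ∃ q ∈ associatedPrimes R (M ⧸ N), ∀ a : R, a • x ∈ N → a ∈ q := by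
  obtain ⟨q, hq, hle⟩ := exists_le_isAssociatedPrime_of_isNoetherianRing R (N.mkQ x)
    (by rwa [mkQ_apply, Ne, Quotient.mk_eq_zero])
  refine ⟨q, hq, fun a ha => hle ?_⟩
  rwa [mem_colon_singleton, ← map_smul, mem_bot, mkQ_apply, Quotient.mk_eq_zero]

theorem IsPrimeExtension.smul_mem {p : Ideal R} {N K : Submodule R M}
    (h : IsPrimeExtension p N K) {a : R} (ha : a ∈ p) {x : M} (hx : x ∈ K) : a • x ∈ N := by
  rw [← h.2.2.1] at ha
  exact mem_colon.1 ha x hx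

/-- A regular `p`-prime extension of `N` is the submodule of elements killed by `p` modulo `N`. -/
theorem IsRegularPrimeExtension.mem_iff [IsNoetherianRing R] {p : Ideal R}
    {N K : Submodule R M} (h : IsRegularPrimeExtension p N K) {x : M} :
    x ∈ K ↔ ∀ a ∈ p, a • x ∈ N := by
  obtain ⟨⟨hK, hmax⟩, hp, hpmax⟩ := h
  refine ⟨fun hx a ha => hK.smul_mem ha hx, fun hx => ?_⟩
  let L : Submodule R M :=
    { carrier := {y | ∀ a ∈ p, a • y ∈ N}
      add_mem' := fun hy hz a ha => by
        rw [smul_add]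
        exact N.add_mem (hy a ha) (hz a ha)
      zero_mem' := fun a _ => by simp
      smul_mem' := fun c y hy a ha => by
        rw [smul_comm]
        exact N.smul_mem c (hy a ha) }
  have hKL : K ≤ L := fun y hy a ha => hK.smul_mem ha hy
  have hL : IsPrimeExtension p N L := by
    refine ⟨hK.1, hK.2.1.trans hKL, le_antisymm (fun a ha => ?_) fun a ha =>
      mem_colon.2 fun y hy => hy a ha, fun a y hy hay => ?_⟩
    · obtain ⟨-, z, hz⟩ := mem_associatedPrimes_quotient_iff.1 hp
      exact (hz a).2 (mem_colon.1 ha z fun b hb => (hz b).1 hb)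
    · by_contra! hcon
      obtain ⟨q, hq, hyq⟩ := exists_mem_associatedPrimes_quotient_of_notMem hcon.2
      rw [hpmax q hq fun b hb => hyq b (hy b hb)] at hyq
      exact hcon.1 (hyq a hay)
  by_contra hxK
  exact hmax L hL (lt_of_le_of_ne hKL fun hEq => hxK (hEq ▸ hx))

theorem IsRegularPrimeExtension.associatedPrimes_quotient_subset [IsNoetherianRing R]
    {p : Ideal R} {N K : Submodule R M} (h : IsRegularPrimeExtension p N K) :
    associatedPrimes R (M ⧸ K) ⊆ associatedPrimes R (M ⧸ N) := by
  intro q hq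
  obtain ⟨hqp, x, hx⟩ := mem_associatedPrimes_quotient_iff.1 hq
  obtain ⟨s, hs⟩ := IsNoetherian.noetherian p
  let J (b : R) : Ideal R := N.comap (LinearMap.toSpanSingleton R M (b • x))
  have hJ (a b : R) : a ∈ J b ↔ a • b • x ∈ N := by simp [J]
  have hle : s.inf J ≤ q := by
    intro a ha
    rw [Submodule.mem_finsetInf] at ha
    rw [hx, h.mem_iff]
    have hps : p ≤ N.comap (LinearMap.toSpanSingleton R M (a • x)) := by
      rw [← hs, span_le]
      intro b hb
      have := (hJ a b).1 (ha b hb)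
      rw [smul_comm] at this
      simpa using this
    intro b hb
    simpa using hps hb
  obtain ⟨b, hb, hbq⟩ := (Ideal.IsPrime.inf_le' hqp).1 hle
  refine mem_associatedPrimes_quotient_iff.2 ⟨hqp, b • x, fun a => ⟨fun ha => ?_, fun ha =>
    hbq ((hJ a b).2 ha)⟩⟩
  rw [smul_comm]
  exact h.mem_iff.1 ((hx a).1 ha) b (hs ▸ subset_span hb)

theorem IsPrimeExtension.associatedPrimes_quotient_subset_insert [IsNoetherianRing R]
    {p : Ideal R} {N K : Submodule R M} (h : IsPrimeExtension p N K) :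
    associatedPrimes R (M ⧸ N) ⊆ insert p (associatedPrimes R (M ⧸ K)) := by
  intro q hq
  obtain ⟨hqp, x, hx⟩ := mem_associatedPrimes_quotient_iff.1 hq
  by_cases hcase : ∃ a : R, a • x ∈ K ∧ a • x ∉ N
  · obtain ⟨a, haK, haN⟩ := hcase
    left
    ext b
    constructor
    · intro hb
      refine (h.2.2.2 b _ haK ?_).resolve_right haN
      rw [smul_comm]
      exact N.smul_mem a ((hx b).1 hb)
    · intro hb
      have hba := h.smul_mem hb haK
      rw [smul_smul, ← hx] at hba
      exact (hqp.mem_or_mem hba).resolve_right fun ha => haN ((hx a).1 ha)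
  · push Not at hcase
    exact Or.inr (mem_associatedPrimes_quotient_iff.2
      ⟨hqp, x, fun a => (hx a).trans ⟨fun ha => h.2.1 ha, hcase a⟩⟩)

theorem IsRegularPrimeExtension.associatedPrimes_quotient_eq_insert [IsNoetherianRing R]
    {p : Ideal R} {N K : Submodule R M} (h : IsRegularPrimeExtension p N K) :
    associatedPrimes R (M ⧸ N) = insert p (associatedPrimes R (M ⧸ K)) :=
  h.1.1.associatedPrimes_quotient_subset_insert.antisymm
    (Set.insert_subset h.2.1 h.associatedPrimes_quotient_subset)

theorem IsRPEFiltration.associatedPrimes_quotient_eq [IsNoetherianRing R] {N : Submodule R M}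
    {n : ℕ} {F : Fin (n + 1) → Submodule R M} {p : Fin n → Ideal R}
    (h : IsRPEFiltration N n F p) (i : Fin (n + 1)) :
    associatedPrimes R (M ⧸ F i) = {q | ∃ j : Fin n, i ≤ j.castSucc ∧ p j = q} := by
  induction i using Fin.reverseInduction with
  | last =>
    have : Subsingleton (M ⧸ F (Fin.last n)) := Submodule.Quotient.subsingleton_iff.2 h.2.1
    rw [associatedPrimes.eq_empty_of_subsingleton, eq_comm, Set.eq_empty_iff_forall_notMem]
    rintro q ⟨j, hj, -⟩
    exact (Fin.castSucc_lt_last j).not_ge hj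
  | cast i ih =>
    rw [(h.2.2 i).associatedPrimes_quotient_eq_insert, ih]
    ext q
    simp only [Set.mem_insert_iff, Set.mem_ofPred_eq, Fin.castSucc_le_castSucc_iff,
      Fin.succ_le_castSucc_iff]
    constructor
    · rintro (rfl | ⟨j, hj, rfl⟩)
      · exact ⟨i, le_rfl, rfl⟩
      · exact ⟨j, hj.le, rfl⟩
    · rintro ⟨j, hj, rfl⟩
      rcases hj.eq_or_lt with rfl | hlt
      · exact Or.inl rfl
      · exact Or.inr ⟨j, hlt, rfl⟩

end AssociatedPrimes

/-- If `N = M_0 ⊂ M_1 ⊂ ⋯ ⊂ M_n = M` is an RPE filtration of `M` over a proper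
submodule `N` with primes `p_1, …, p_n`, then `Ass(M/M_{i-1}) = {p_i, …, p_n}` for all
`1 ≤ i ≤ n`; in particular `Ass(M/N) = {p_1, …, p_n}`. -/
theorem stmt_0 {R : Type*} [CommRing R] [IsNoetherianRing R]
    {M : Type*} [AddCommGroup M] [Module R M] [Module.Finite R M]
    (N : Submodule R M) (hN : N ≠ ⊤) (n : ℕ)
    (F : Fin (n + 1) → Submodule R M) (p : Fin n → Ideal R)
    (hF : IsRPEFiltration N n F p) :
    (∀ i : Fin n,
      associatedPrimes R (M ⧸ F i.castSucc) = {q | ∃ j : Fin n, i ≤ j ∧ p j = q}) ∧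
    associatedPrimes R (M ⧸ N) = Set.range p := by
  refine ⟨fun i => by simpa using hF.associatedPrimes_quotient_eq i.castSucc, ?_⟩
  rw [← hF.1, hF.associatedPrimes_quotient_eq 0]
  ext q
  simp
end

section
/- Let R be a commutative Noetherian ring, M a finitely generated R-module, and p a prime ideal of R that is a maximal element of Ass_R(M/N) for a proper submodule N of M. Then (N :_M p) = {x ∈ M : p x ⊆ N} is the unique maximal p-prime extension of N in M; that is, (N :_M p) is a p-prime extension of N, and every p-prime extension of N in M is contained in (N :_M p). -/
open Submodule

/-- The submodule `(N :_M p) = {x ∈ M : p x ⊆ N}`. -/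
def modColon {R : Type*} [CommRing R] {M : Type*} [AddCommGroup M] [Module R M]
    (N : Submodule R M) (I : Ideal R) : Submodule R M :=
  ⨅ r ∈ I, N.comap (r • (LinearMap.id : M →ₗ[R] M))

/-- If `p` is a maximal element of `Ass(M/N)` for a proper submodule `N` of `M`,
then `(N :_M p) = {x ∈ M : p x ⊆ N}` is the unique maximal `p`-prime extension of
`N` in `M`: it is a `p`-prime extension of `N` and every `p`-prime extension of `N`
in `M` is contained in it. -/
theorem stmt_3 {R : Type*} [CommRing R] [IsNoetherianRing R]
    {M : Type*} [AddCommGroup M] [Module R M] [Module.Finite R M]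
    (N : Submodule R M) (hN : N ≠ ⊤) (p : Ideal R) (hp : p.IsPrime)
    (hmem : p ∈ associatedPrimes R (M ⧸ N))
    (hmax : ∀ q ∈ associatedPrimes R (M ⧸ N), p ≤ q → q = p) :
    (∀ x : M, x ∈ modColon N p ↔ ∀ r ∈ p, r • x ∈ N) ∧
    IsPrimeExtension p N (modColon N p) ∧
    ∀ L : Submodule R M, IsPrimeExtension p N L → L ≤ modColon N p := by
  have mem_modColon : ∀ x : M, x ∈ modColon N p ↔ ∀ r ∈ p, r • x ∈ N := by
    intro x
    simp [modColon, Submodule.mem_iInf]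
  have mem_colon_mk : ∀ (x : M) (a : R),
      a ∈ (⊥ : Submodule R (M ⧸ N)).colon {N.mkQ x} ↔ a • x ∈ N := by
    intro x a
    rw [Submodule.mem_colon_singleton, Submodule.mem_bot, ← map_smul, Submodule.mkQ_apply,
      Submodule.Quotient.mk_eq_zero]
  obtain ⟨-, y, hy⟩ := isAssociatedPrime_iff.mp hmem
  obtain ⟨x₀, rfl⟩ := N.mkQ_surjective y
  have mem_p : ∀ a : R, a ∈ p ↔ a • x₀ ∈ N := by
    intro a
    rw [← mem_colon_mk, ← hy]
  refine ⟨mem_modColon, ⟨hp, ?_, ?_, ?_⟩, ?_⟩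
  · exact fun x hx ↦ (mem_modColon x).2 fun r _ ↦ N.smul_mem r hx
  · ext a
    rw [Submodule.mem_colon]
    refine ⟨fun h ↦ (mem_p a).2 (h x₀ ?_), fun ha x hx ↦ (mem_modColon x).1 hx a ha⟩
    exact (mem_modColon x₀).2 fun r hr ↦ (mem_p r).1 hr
  · intro a x hx hax
    refine or_iff_not_imp_right.2 fun hxN ↦ ?_
    have hne : N.mkQ x ≠ 0 := by
      rwa [Submodule.mkQ_apply, Ne, Submodule.Quotient.mk_eq_zero]
    obtain ⟨q, hq, hle⟩ := exists_le_isAssociatedPrime_of_isNoetherianRing R (N.mkQ x) hne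
    have hpq : p ≤ q := fun r hr ↦ hle ((mem_colon_mk x r).2 ((mem_modColon x).1 hx r hr))
    rw [← hmax q hq hpq]
    exact hle ((mem_colon_mk x a).2 hax)
  · rintro L ⟨-, -, hL, -⟩ x hx
    refine (mem_modColon x).2 fun r hr ↦ ?_
    rw [← hL] at hr
    exact Submodule.mem_colon.1 hr x hx
end

section
/- Let R be a commutative Noetherian ring, M a finitely generated R-module, and p a prime ideal of R. Suppose N_2 is a regular p-prime extension of N_1 in M and K_2 is a regular p-prime extension of K_1 in M. If N_1 ∩ K_1 ≠ N_2 ∩ K_2, then N_2 ∩ K_2 is a regular p-prime extension of N_1 ∩ K_1 in M. -/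
open Submodule

namespace PrimeExtension

variable {R : Type*} [CommRing R] {M : Type*} [AddCommGroup M] [Module R M]

/-- The submodule of elements `x` with `p x ⊆ N`. -/
def residual (p : Ideal R) (N : Submodule R M) : Submodule R M where
  carrier := {x | ∀ a ∈ p, a • x ∈ N}
  add_mem' hx hy a ha := by
    rw [smul_add]
    exact N.add_mem (hx a ha) (hy a ha)
  zero_mem' a _ := by simp
  smul_mem' c x hx a ha := by
    rw [smul_comm]
    exact N.smul_mem c (hx a ha)

theorem mem_residual {p : Ideal R} {N : Submodule R M} {x : M} :
    x ∈ residual p N ↔ ∀ a ∈ p, a • x ∈ N := Iff.rfl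

theorem residual_inf (p : Ideal R) (N K : Submodule R M) :
    residual p (N ⊓ K) = residual p N ⊓ residual p K := by
  ext x
  simp only [mem_residual, Submodule.mem_inf]
  exact ⟨fun h => ⟨fun a ha => (h a ha).1, fun a ha => (h a ha).2⟩,
    fun h a ha => ⟨h.1 a ha, h.2 a ha⟩⟩

theorem le_residual (p : Ideal R) (N : Submodule R M) : N ≤ residual p N :=
  fun _ hx a _ => N.smul_mem a hx

theorem _root_.IsPrimeExtension.le_residual {p : Ideal R} {N K : Submodule R M}
    (h : IsPrimeExtension p N K) : K ≤ residual p N := by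
  intro x hx a ha
  rw [← h.2.2.1] at ha
  exact Submodule.mem_colon.1 ha x hx

theorem associatedPrimes_quotient_inf_subset (N K : Submodule R M) :
    associatedPrimes R (M ⧸ (N ⊓ K)) ⊆ associatedPrimes R (M ⧸ N) ∪ associatedPrimes R (M ⧸ K) := by
  rw [← associatedPrimes.prod]
  have hker : LinearMap.ker (N.mkQ.prod K.mkQ) = N ⊓ K := by
    rw [LinearMap.ker_prod, Submodule.ker_mkQ, Submodule.ker_mkQ]
  exact associatedPrimes.subset_of_injective
    (f := (N ⊓ K).liftQ (N.mkQ.prod K.mkQ) hker.ge)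
    (LinearMap.ker_eq_bot.1 (Submodule.ker_liftQ_eq_bot _ _ _ hker.le))

variable [IsNoetherianRing R]

theorem exists_associatedPrime_ge {N : Submodule R M} {x : M} (hx : x ∉ N) :
    ∃ q ∈ associatedPrimes R (M ⧸ N), ∀ a : R, a • x ∈ N → a ∈ q := by
  obtain ⟨q, hq, hle⟩ := exists_le_isAssociatedPrime_of_isNoetherianRing R (N.mkQ x)
    (by simpa using hx)
  refine ⟨q, hq, fun a ha => hle ?_⟩
  rw [Submodule.mem_colon_singleton, Submodule.mem_bot, ← map_smul]
  exact (Submodule.Quotient.mk_eq_zero N).2 ha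

theorem mem_associatedPrimes_of_mem_residual {p : Ideal R} {N : Submodule R M}
    (hmax : ∀ q ∈ associatedPrimes R (M ⧸ N), p ≤ q → q = p)
    {x : M} (hx : x ∈ residual p N) (hxN : x ∉ N) :
    p ∈ associatedPrimes R (M ⧸ N) ∧ ∀ a : R, a • x ∈ N → a ∈ p := by
  obtain ⟨q, hq, h⟩ := exists_associatedPrime_ge hxN
  obtain rfl := hmax q hq fun a ha => h a (hx a ha)
  exact ⟨hq, h⟩

theorem isRegularPrimeExtension_residual {p : Ideal R} {N : Submodule R M}
    (hmax : ∀ q ∈ associatedPrimes R (M ⧸ N), p ≤ q → q = p) (hne : N ≠ residual p N) :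
    IsRegularPrimeExtension p N (residual p N) := by
  obtain ⟨x, hx, hxN⟩ := SetLike.exists_of_lt (lt_of_le_of_ne (le_residual p N) hne)
  obtain ⟨hp, hcolon⟩ := mem_associatedPrimes_of_mem_residual hmax hx hxN
  refine ⟨⟨⟨IsAssociatedPrime.isPrime hp, le_residual p N, le_antisymm ?_ ?_, ?_⟩,
    fun L hL => hL.le_residual.not_gt⟩, hp, hmax⟩
  · exact fun a ha => hcolon a (Submodule.mem_colon.1 ha x hx)
  · exact fun a ha => Submodule.mem_colon.2 fun y hy => hy a ha
  · intro a y hy hay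
    by_cases hyN : y ∈ N
    · exact Or.inr hyN
    · exact Or.inl ((mem_associatedPrimes_of_mem_residual hmax hy hyN).2 a hay)

theorem _root_.IsRegularPrimeExtension.eq_residual {p : Ideal R} {N K : Submodule R M}
    (h : IsRegularPrimeExtension p N K) : K = residual p N := by
  obtain ⟨⟨hK, hKmax⟩, -, hmax⟩ := h
  have hle := hK.le_residual
  have hne : N ≠ residual p N := by
    intro heq
    have hKN : K ≤ N := hle.trans heq.ge
    refine hK.1.ne_top (hK.2.2.1.symm.trans ?_)
    exact (Ideal.eq_top_iff_one _).2 (Submodule.mem_colon.2 fun y hy => by simpa using hKN hy)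
  by_contra hKne
  exact hKmax _ (isRegularPrimeExtension_residual hmax hne).1.1 (lt_of_le_of_ne hle hKne)

end PrimeExtension

/-- If `N_2` is a regular `p`-prime extension of `N_1` in `M`, `K_2` is a regular
`p`-prime extension of `K_1` in `M`, and `N_1 ∩ K_1 ≠ N_2 ∩ K_2`, then `N_2 ∩ K_2`
is a regular `p`-prime extension of `N_1 ∩ K_1` in `M`. -/
theorem stmt_5 {R : Type*} [CommRing R] [IsNoetherianRing R]
    {M : Type*} [AddCommGroup M] [Module R M] [Module.Finite R M]
    (p : Ideal R) (N₁ N₂ K₁ K₂ : Submodule R M)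
    (hN : IsRegularPrimeExtension p N₁ N₂)
    (hK : IsRegularPrimeExtension p K₁ K₂)
    (hne : N₁ ⊓ K₁ ≠ N₂ ⊓ K₂) :
    IsRegularPrimeExtension p (N₁ ⊓ K₁) (N₂ ⊓ K₂) := by
  obtain rfl := hN.eq_residual
  obtain rfl := hK.eq_residual
  rw [← PrimeExtension.residual_inf] at hne ⊢
  refine PrimeExtension.isRegularPrimeExtension_residual (fun q hq hpq => ?_) hne
  rcases PrimeExtension.associatedPrimes_quotient_inf_subset N₁ K₁ hq with h | h
  · exact hN.2.2 q h hpq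
  · exact hK.2.2 q h hpq
end

section
/- Let R be a commutative Noetherian ring, M a finitely generated R-module, and N a submodule of M whose generalized prime ideal factorization is P_M(N) = p_1 p_2 ⋯ p_n. If 1 ≤ i ≤ n is such that p_i does not contain p_j for every 1 ≤ j ≤ n with j ≠ i, then p_1 ⋯ p_{i-1} p_{i+1} ⋯ p_n M ⊄ N (the product of all the factors except p_i applied to M is not contained in N). -/
open Submodule

theorem IsRPEFiltration.monotone {R : Type*} [CommRing R] {M : Type*} [AddCommGroup M]
    [Module R M] {N : Submodule R M} {n : ℕ} {F : Fin (n + 1) → Submodule R M}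
    {p : Fin n → Ideal R} (h : IsRPEFiltration N n F p) : Monotone F :=
  Fin.monotone_iff_le_succ.mpr fun k => (h.2.2 k).1.1.2.1

/-- If `P_M(N) = p_1 ⋯ p_n` and `p_i` does not contain `p_j` for every `j ≠ i`, then
`p_1 ⋯ p_{i-1} p_{i+1} ⋯ p_n M ⊄ N`. -/
theorem stmt_6 {R : Type*} [CommRing R] [IsNoetherianRing R]
    {M : Type*} [AddCommGroup M] [Module R M] [Module.Finite R M]
    (N : Submodule R M) (n : ℕ) (p : Fin n → Ideal R)
    (hfac : HasPFactorization N (List.ofFn p : Multiset (Ideal R)))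
    (i : Fin n) (hi : ∀ j : Fin n, j ≠ i → ¬ p j ≤ p i) :
    ¬ ((∏ j ∈ Finset.univ.erase i, p j) • (⊤ : Submodule R M) ≤ N) := by
  intro hle
  obtain ⟨m, F, q, hF, hq⟩ := hfac
  have hmem : p i ∈ List.ofFn q :=
    (Multiset.coe_eq_coe.mp hq).mem_iff.mpr (List.mem_ofFn.mpr ⟨i, rfl⟩)
  obtain ⟨k, hk⟩ := List.mem_ofFn.mp hmem
  obtain ⟨hprime, -, hcolon, -⟩ := (hF.2.2 k).1.1
  rw [hk] at hprime hcolon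
  have hprod : ∏ j ∈ Finset.univ.erase i, p j ≤ p i := by
    intro a ha
    rw [← hcolon, Submodule.mem_colon]
    intro x _
    have hN : N ≤ F k.castSucc := hF.1 ▸ hF.monotone (Fin.zero_le _)
    exact hN (hle (Submodule.smul_mem_smul ha Submodule.mem_top))
  obtain ⟨j, hj, hji⟩ := hprime.prod_le.mp hprod
  exact hi j (Finset.ne_of_mem_erase hj) hji
end

section
/- Let R be a commutative Noetherian ring, M a finitely generated R-module, and N, K proper submodules of M having the same generalized prime ideal factorization P_M(N) = P_M(K) = p_1 p_2 ⋯ p_n, where the primes satisfy p_i ⊅ p_j for all i ≠ j (the factors are pairwise incomparable under inclusion, counted with multiplicity). Then P_M(N ∩ K) = P_M(N); that is, the intersection N ∩ K has the same generalized prime ideal factorization as N and K. -/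
open Submodule

section PrimeDecomposition

variable {R : Type*} [CommRing R] {M : Type*} [AddCommGroup M] [Module R M]

/-- The kernel of `M → (M ⧸ N)ₚ`: elements carried into `N` by some scalar outside `p`. -/
def primeComponent (N : Submodule R M) (p : Ideal R) [p.IsPrime] : Submodule R M where
  carrier := {x | ∃ s ∉ p, s • x ∈ N}
  zero_mem' := ⟨1, (Ideal.ne_top_iff_one p).mp Ideal.IsPrime.ne_top', by simp⟩
  add_mem' := by
    rintro x y ⟨s, hs, hx⟩ ⟨t, ht, hy⟩
    refine ⟨s * t, fun h => (Ideal.IsPrime.mem_or_mem ‹_› h).elim hs ht, ?_⟩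
    rw [smul_add]
    refine N.add_mem ?_ ?_
    · rw [mul_comm, mul_smul]
      exact N.smul_mem t hx
    · rw [mul_smul]
      exact N.smul_mem s hy
  smul_mem' := by
    rintro r x ⟨s, hs, hx⟩
    refine ⟨s, hs, ?_⟩
    rw [smul_comm]
    exact N.smul_mem r hx

theorem mem_primeComponent {N : Submodule R M} {p : Ideal R} [p.IsPrime] {x : M} :
    x ∈ primeComponent N p ↔ ∃ s ∉ p, s • x ∈ N := Iff.rfl

theorem le_primeComponent (N : Submodule R M) (p : Ideal R) [hp : p.IsPrime] :
    N ≤ primeComponent N p :=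
  fun x hx => ⟨1, (Ideal.ne_top_iff_one p).mp hp.ne_top, by simpa using hx⟩

theorem IsPrimeExtension.not_le {p : Ideal R} {N K : Submodule R M}
    (h : IsPrimeExtension p N K) : ¬ K ≤ N := fun hle =>
  h.1.ne_top (h.2.2.1 ▸ (Submodule.colon_eq_top_iff_subset (K : Set M)).mpr hle)

theorem isPrimeExtension_of_not_le {p : Ideal R} {N K : Submodule R M} (hp : p.IsPrime)
    (hNK : N ≤ K) (hKN : ¬ K ≤ N) (hsmul : ∀ a ∈ p, ∀ x ∈ K, a • x ∈ N)
    (hprime : ∀ (a : R) (x : M), x ∈ K → a • x ∈ N → a ∈ p ∨ x ∈ N) :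
    IsPrimeExtension p N K := by
  refine ⟨hp, hNK, le_antisymm (fun a ha => ?_) (fun a ha => ?_), hprime⟩
  · obtain ⟨x, hxK, hxN⟩ := SetLike.not_le_iff_exists.mp hKN
    exact (hprime a x hxK (Submodule.mem_colon.mp ha x hxK)).resolve_right hxN
  · exact Submodule.mem_colon.mpr (hsmul a ha)

theorem IsPrimeExtension.inf_top {p : Ideal R} {A B : Submodule R M}
    (hA : IsPrimeExtension p A ⊤) (hB : IsPrimeExtension p B ⊤) :
    IsPrimeExtension p (A ⊓ B) ⊤ := by
  refine isPrimeExtension_of_not_le hA.1 le_top (fun h => hA.not_le (h.trans inf_le_left))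
    (fun a ha x hx => ⟨hA.smul_mem ha hx, hB.smul_mem ha hx⟩) (fun a x hx h => ?_)
  by_cases ha : a ∈ p
  · exact Or.inl ha
  · exact Or.inr ⟨(hA.2.2.2 a x hx h.1).resolve_left ha, (hB.2.2.2 a x hx h.2).resolve_left ha⟩

theorem prod_smul_mem_of_chain {n : ℕ} {F : Fin (n + 1) → Submodule R M} {q : Fin n → Ideal R}
    (hlast : F (Fin.last n) = ⊤)
    (hF : ∀ i : Fin n, IsPrimeExtension (q i) (F i.castSucc) (F i.succ))
    {t : Fin n → R} (ht : ∀ i, t i ∈ q i) (x : M) : (∏ i, t i) • x ∈ F 0 := by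
  have key : ∀ k : Fin (n + 1),
      (∏ i ∈ Finset.univ.filter (fun i : Fin n => k ≤ i.castSucc), t i) • x ∈ F k := by
    intro k
    induction k using Fin.reverseInduction with
    | last => simp [hlast]
    | cast j ih =>
      have hins : Finset.univ.filter (fun i : Fin n => j.castSucc ≤ i.castSucc) =
          insert j (Finset.univ.filter (fun i : Fin n => j.succ ≤ i.castSucc)) := by
        ext i
        simp only [Finset.mem_filter, Finset.mem_univ, true_and, Finset.mem_insert, Fin.le_def,
          Fin.ext_iff, Fin.val_castSucc, Fin.val_succ]
        omega
      rw [hins, Finset.prod_insert (by simp), mul_smul]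
      exact (hF j).smul_mem (ht j) ih
  simpa using key 0

theorem isPrimeExtension_primeComponent {n : ℕ} {F : Fin (n + 1) → Submodule R M}
    {q : Fin n → Ideal R} (hlast : F (Fin.last n) = ⊤)
    (hF : ∀ i : Fin n, IsPrimeExtension (q i) (F i.castSucc) (F i.succ))
    (hq : ∀ i j : Fin n, i ≠ j → ¬ q j ≤ q i) (i : Fin n) [hp : (q i).IsPrime] :
    IsPrimeExtension (q i) (primeComponent (F 0) (q i)) ⊤ := by
  refine isPrimeExtension_of_not_le hp le_top (fun htop => ?_) (fun a ha x _ => ?_)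
    (fun a x _ hax => ?_)
  · have hmono : Monotone F := Fin.monotone_iff_le_succ.mpr fun j => (hF j).2.1
    obtain ⟨x, hx, hx'⟩ := SetLike.not_le_iff_exists.mp (hF i).not_le
    obtain ⟨s, hs, hsx⟩ := mem_primeComponent.mp (htop (Submodule.mem_top (x := x)))
    exact ((hF i).2.2.2 s x hx (hmono (Fin.zero_le _) hsx)).elim hs hx'
  · have hex : ∀ j, ∃ s, s ∈ q j ∧ (j ≠ i → s ∉ q i) := fun j => by
      by_cases hj : j = i
      · exact ⟨0, zero_mem _, fun h => absurd hj h⟩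
      · obtain ⟨s, hs, hs'⟩ := SetLike.not_le_iff_exists.mp (hq i j (Ne.symm hj))
        exact ⟨s, hs, fun _ => hs'⟩
    choose s hs hs' using hex
    refine ⟨∏ j ∈ Finset.univ.erase i, s j, fun h => ?_, ?_⟩
    · obtain ⟨j, hj, hj'⟩ := (hp.prod_mem_iff).mp h
      exact hs' j (Finset.ne_of_mem_erase hj) hj'
    · have hmem := prod_smul_mem_of_chain hlast hF (t := Function.update s i a) (fun j => by
        by_cases hj : j = i
        · subst hj
          simpa using ha
        · simpa [hj] using hs j) x
      rw [← Finset.prod_erase_mul _ _ (Finset.mem_univ i), Function.update_self, mul_smul] at hmem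
      rwa [Finset.prod_congr rfl fun j hj =>
        (Function.update_of_ne (Finset.ne_of_mem_erase hj) a s).symm]
  · obtain ⟨s, hs, hsx⟩ := mem_primeComponent.mp hax
    refine or_iff_not_imp_left.mpr fun ha => ⟨s * a, fun h => (hp.mem_or_mem h).elim hs ha, ?_⟩
    rwa [mul_smul]

theorem mem_of_forall_exists_smul_mem {n : ℕ} {F : Fin (n + 1) → Submodule R M}
    {q : Fin n → Ideal R} (hlast : F (Fin.last n) = ⊤)
    (hF : ∀ i : Fin n, IsPrimeExtension (q i) (F i.castSucc) (F i.succ)) {x : M}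
    (hx : ∀ i, ∃ s ∉ q i, s • x ∈ F 0) : x ∈ F 0 := by
  have hmono : Monotone F := Fin.monotone_iff_le_succ.mpr fun j => (hF j).2.1
  have key : ∀ k : Fin (n + 1), x ∈ F k := by
    intro k
    induction k using Fin.reverseInduction with
    | last => simp [hlast]
    | cast j ih =>
      obtain ⟨s, hs, hsx⟩ := hx j
      exact ((hF j).2.2.2 s x ih (hmono (Fin.zero_le _) hsx)).resolve_left hs
  exact key 0

theorem HasPFactorization.exists_eq_iInf {N : Submodule R M} {n : ℕ} {p : Fin n → Ideal R}
    (h : HasPFactorization N (List.ofFn p : Multiset (Ideal R)))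
    (hinc : ∀ i j : Fin n, i ≠ j → ¬ p j ≤ p i) :
    ∃ L : Fin n → Submodule R M, (∀ i, IsPrimeExtension (p i) (L i) ⊤) ∧ N = ⨅ i, L i := by
  obtain ⟨m, F, q, ⟨rfl, hlast, hreg⟩, hS⟩ := h
  have hF : ∀ i : Fin m, IsPrimeExtension (q i) (F i.castSucc) (F i.succ) :=
    fun i => (hreg i).1.1
  have hperm : (List.ofFn q).Perm (List.ofFn p) := Multiset.coe_eq_coe.mp hS
  have hpair : (List.ofFn q).Pairwise (fun a b => ¬ a ≤ b ∧ ¬ b ≤ a) := by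
    rw [hperm.pairwise_iff fun h => ⟨h.2, h.1⟩, List.pairwise_ofFn]
    exact fun i j hij => ⟨hinc j i hij.ne', hinc i j hij.ne⟩
  have hq : ∀ i j : Fin m, i ≠ j → ¬ q j ≤ q i := fun i j hij => by
    rw [List.pairwise_ofFn] at hpair
    rcases lt_or_gt_of_ne hij with h | h
    · exact (hpair h).2
    · exact (hpair h).1
  have hpq : ∀ i, ∃ j, q j = p i := fun i =>
    List.mem_ofFn.mp (hperm.mem_iff.mpr (List.mem_ofFn.mpr ⟨i, rfl⟩))
  have hqp : ∀ j, ∃ i, p i = q j := fun j =>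
    List.mem_ofFn.mp (hperm.mem_iff.mp (List.mem_ofFn.mpr ⟨j, rfl⟩))
  have hprime : ∀ i, (p i).IsPrime := fun i => by
    obtain ⟨j, hj⟩ := hpq i
    exact hj ▸ (hF j).1
  refine ⟨fun i => primeComponent (F 0) (p i), fun i => ?_, le_antisymm
    (le_iInf fun i => le_primeComponent _ _) fun x hx => ?_⟩
  · obtain ⟨j, hj⟩ := hpq i
    have : (q j).IsPrime := (hF j).1
    simp only [← hj]
    exact isPrimeExtension_primeComponent hlast hF hq j
  · refine mem_of_forall_exists_smul_mem hlast hF fun j => ?_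
    obtain ⟨i, hi⟩ := hqp j
    rw [← hi]
    exact mem_primeComponent.mp (Submodule.mem_iInf _ |>.mp hx i)

theorem hasPFactorization_iInf {n : ℕ} {p : Fin n → Ideal R} {L : Fin n → Submodule R M}
    (hL : ∀ i, IsPrimeExtension (p i) (L i) ⊤) (hinc : ∀ i j : Fin n, i ≠ j → ¬ p j ≤ p i) :
    HasPFactorization (⨅ i, L i) (List.ofFn p : Multiset (Ideal R)) := by
  set F : Fin (n + 1) → Submodule R M := fun k => ⨅ i : Fin n, ⨅ _ : k ≤ i.castSucc, L i with hFdef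
  have mem_F : ∀ {k x}, x ∈ F k ↔ ∀ i : Fin n, k ≤ i.castSucc → x ∈ L i := by
    simp [hFdef, Submodule.mem_iInf]
  have mem_castSucc : ∀ {j : Fin n} {x}, x ∈ F j.castSucc ↔ x ∈ L j ∧ x ∈ F j.succ := by
    intro j x
    rw [mem_F, mem_F]
    refine ⟨fun h => ⟨h j le_rfl, fun i hi => h i ((Fin.castSucc_lt_succ).le.trans hi)⟩,
      fun h i hi => ?_⟩
    rcases (Fin.castSucc_le_castSucc_iff.mp hi).eq_or_lt with rfl | hlt
    · exact h.1
    · exact h.2 i (by simpa [Fin.le_def, Nat.succ_le_iff] using hlt)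
  have hext : ∀ j : Fin n, IsPrimeExtension (p j) (F j.castSucc) (F j.succ) := by
    intro j
    refine isPrimeExtension_of_not_le (hL j).1 (fun x hx => (mem_castSucc.mp hx).2) (fun hle => ?_)
      (fun a ha x hx => mem_castSucc.mpr ⟨(hL j).smul_mem ha trivial, Submodule.smul_mem _ a hx⟩)
      (fun a x hx hax => ((hL j).2.2.2 a x trivial (mem_castSucc.mp hax).1).imp_right
        fun h => mem_castSucc.mpr ⟨h, hx⟩)
    have hex : ∀ i, ∃ s, (i ≠ j → s ∈ p i) ∧ s ∉ p j := fun i => by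
      by_cases hi : i = j
      · exact ⟨1, fun h => absurd hi h, (Ideal.ne_top_iff_one _).mp (hL j).1.ne_top⟩
      · obtain ⟨s, hs, hs'⟩ := SetLike.not_le_iff_exists.mp (hinc j i (Ne.symm hi))
        exact ⟨s, fun _ => hs, hs'⟩
    choose s hs hs' using hex
    refine (hL j).not_le fun x _ => ?_
    have hx : (∏ i, s i) • x ∈ F j.succ := mem_F.mpr fun i hi => by
      have hij : i ≠ j := by
        rintro rfl
        simp [Fin.le_def] at hi
      exact (hL i).smul_mem (Ideal.mem_of_dvd _ (Finset.dvd_prod_of_mem s (Finset.mem_univ i))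
        (hs i hij)) trivial
    refine ((hL j).2.2.2 _ x trivial (mem_castSucc.mp (hle hx)).1).resolve_left fun h => ?_
    obtain ⟨i, -, hi⟩ := ((hL j).1.prod_mem_iff).mp h
    exact hs' i hi
  refine ⟨n, F, p, ⟨by simp [hFdef], ?_, fun j => ⟨⟨hext j, fun K hK hlt => ?_⟩, ?_, ?_⟩⟩, rfl⟩
  · refine eq_top_iff.mpr fun x _ => mem_F.mpr fun i hi => ?_
    exact absurd hi (not_le_of_gt (Fin.castSucc_lt_last i))
  · refine hlt.not_ge fun x hx => mem_F.mpr fun i hi => ?_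
    have hij : i ≠ j := by
      rintro rfl
      simp [Fin.le_def] at hi
    obtain ⟨a, ha, ha'⟩ := SetLike.not_le_iff_exists.mp (hinc i j hij)
    have hax := mem_F.mp (hK.smul_mem ha hx) i ((Fin.castSucc_lt_succ).le.trans hi)
    exact ((hL i).2.2.2 a x trivial hax).resolve_left ha'
  · obtain ⟨x, hx, hx'⟩ := SetLike.not_le_iff_exists.mp (hext j).not_le
    have hcolon : p j = (⊥ : Submodule R (M ⧸ F j.castSucc)).colon {(F j.castSucc).mkQ x} := by
      ext a
      rw [Submodule.mem_colon_singleton, Submodule.mem_bot, ← map_smul, Submodule.mkQ_apply,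
        Submodule.Quotient.mk_eq_zero]
      exact ⟨fun ha => (hext j).smul_mem ha hx,
        fun h => ((hext j).2.2.2 a x hx h).resolve_right hx'⟩
    exact ⟨(hL j).1, _, by rw [← hcolon, (hL j).1.radical]⟩
  · rintro q ⟨hq, y, hqy⟩ hle
    obtain ⟨x, rfl⟩ := (F j.castSucc).mkQ_surjective y
    have hx : x ∉ F j.castSucc := fun hx => hq.ne_top <| by
      rw [hqy, Submodule.mkQ_apply, (Submodule.Quotient.mk_eq_zero _).mpr hx]
      simp
    rw [mem_F] at hx
    push Not at hx
    obtain ⟨i, hi, hxi⟩ := hx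
    have hqi : q ≤ p i := fun a ha => by
      rw [hqy] at ha
      obtain ⟨k, hk⟩ := ha
      rw [Submodule.mem_colon_singleton, Submodule.mem_bot, ← map_smul, Submodule.mkQ_apply,
        Submodule.Quotient.mk_eq_zero] at hk
      exact (hL i).1.mem_of_pow_mem k
        (((hL i).2.2.2 _ x trivial (mem_F.mp hk i hi)).resolve_right hxi)
    have hij : i = j := by
      by_contra hij
      exact hinc i j hij (hle.trans hqi)
    exact le_antisymm (hij ▸ hqi) hle

end PrimeDecomposition

/-- If proper submodules `N` and `K` of `M` have the same generalized prime ideal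
factorization `P_M(N) = P_M(K) = p_1 ⋯ p_n` with the factors pairwise incomparable
under inclusion, then `P_M(N ∩ K) = P_M(N)`. -/
theorem stmt_10 {R : Type*} [CommRing R] [IsNoetherianRing R]
    {M : Type*} [AddCommGroup M] [Module R M] [Module.Finite R M]
    (N K : Submodule R M) (hN : N ≠ ⊤) (hK : K ≠ ⊤)
    (n : ℕ) (p : Fin n → Ideal R)
    (hfN : HasPFactorization N (List.ofFn p : Multiset (Ideal R)))
    (hfK : HasPFactorization K (List.ofFn p : Multiset (Ideal R)))
    (hinc : ∀ i j : Fin n, i ≠ j → ¬ p j ≤ p i) :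
    HasPFactorization (N ⊓ K) (List.ofFn p : Multiset (Ideal R)) := by
  obtain ⟨A, hA, rfl⟩ := hfN.exists_eq_iInf hinc
  obtain ⟨B, hB, rfl⟩ := hfK.exists_eq_iInf hinc
  rw [← iInf_inf_eq]
  exact hasPFactorization_iInf (fun i => (hA i).inf_top (hB i)) hinc
end

section
/- Let R be a commutative Noetherian ring, M a finitely generated R-module, and N a submodule of M whose generalized prime ideal factorization is P_M(N) = p^n for a prime ideal p of R. Then for any submodule K of M, the generalized prime ideal factorization of the ideal (N : K) = {a ∈ R : aK ⊆ N} in R is P_R((N : K)) = p^r for some r ≤ n. -/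
open Submodule

section Helpers

variable {R : Type*} [CommRing R] {M : Type*} [AddCommGroup M] [Module R M]

/-- The elements of the module which are multiplied into `N` by every element of `p`. -/
def primeResidual (N : Submodule R M) (p : Ideal R) : Submodule R M where
  carrier := {x | ∀ a ∈ p, a • x ∈ N}
  add_mem' hx hy a ha := by simpa only [smul_add] using N.add_mem (hx a ha) (hy a ha)
  zero_mem' a _ := by simp
  smul_mem' c x hx a ha := by simpa only [smul_comm a c x] using N.smul_mem c (hx a ha)

/-- Scalars outside `p` act injectively on `M ⧸ N`. -/
def IsSaturatedOff (p : Ideal R) (N : Submodule R M) : Prop :=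
  ∀ (a : R) (x : M), a • x ∈ N → a ∈ p ∨ x ∈ N

theorem le_primeResidual (N : Submodule R M) (p : Ideal R) : N ≤ primeResidual N p :=
  fun _ hx a _ => N.smul_mem a hx

theorem smul_le_iff_le_primeResidual {N K : Submodule R M} {p : Ideal R} :
    p • K ≤ N ↔ K ≤ primeResidual N p := by
  rw [Submodule.smul_le]
  exact ⟨fun h x hx a ha => h a ha x hx, fun h a ha x hx => h hx a ha⟩

theorem IsPrimeExtension.le_primeResidual {p : Ideal R} {N K : Submodule R M}
    (h : IsPrimeExtension p N K) : K ≤ primeResidual N p := by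
  intro x hx a ha
  rw [← h.2.2.1] at ha
  exact Submodule.mem_colon.mp ha x hx

theorem IsPrimeExtension.isSaturatedOff {p : Ideal R} {N K : Submodule R M}
    (h : IsPrimeExtension p N K) (hK : IsSaturatedOff p K) : IsSaturatedOff p N := by
  intro a x hax
  refine (hK a x (h.2.1 hax)).elim Or.inl fun hx => h.2.2.2 a x hx hax

theorem isSaturatedOff_primeResidual {p : Ideal R} {N : Submodule R M}
    (h : IsSaturatedOff p N) : IsSaturatedOff p (primeResidual N p) := by
  intro a x hax
  by_cases ha : a ∈ p
  · exact Or.inl ha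
  · refine Or.inr fun b hb => (h a (b • x) ?_).resolve_left ha
    rw [smul_comm]
    exact hax b hb

theorem isSaturatedOff_colon {p : Ideal R} {N : Submodule R M}
    (h : IsSaturatedOff p N) (S : Set M) : IsSaturatedOff (M := R) p (N.colon S) := by
  intro a b hab
  by_cases ha : a ∈ p
  · exact Or.inl ha
  · refine Or.inr (Submodule.mem_colon.mpr fun s hs => (h a (b • s) ?_).resolve_left ha)
    rw [← mul_smul]
    exact Submodule.mem_colon.mp hab s hs

theorem eq_top_of_primeResidual_le {p : Ideal R} {N : Submodule R M} (h : primeResidual N p ≤ N) :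
    ∀ {n : ℕ}, p ^ n • (⊤ : Submodule R M) ≤ N → N = ⊤
  | 0, hn => by simpa using hn
  | n + 1, hn => by
    rw [pow_succ', Submodule.mul_smul, smul_le_iff_le_primeResidual] at hn
    exact eq_top_of_primeResidual_le h (hn.trans h)

theorem IsSaturatedOff.isRegularPrimeExtension {p : Ideal R} [hp : p.IsPrime]
    {N : Submodule R M} (h : IsSaturatedOff p N) (hN : ¬ primeResidual N p ≤ N) :
    IsRegularPrimeExtension p N (primeResidual N p) := by
  obtain ⟨x, hx, hxN⟩ := SetLike.not_le_iff_exists.mp hN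
  refine ⟨⟨⟨hp, le_primeResidual N p, ?_, fun a y _ => h a y⟩,
    fun L hL => not_lt_of_ge hL.le_primeResidual⟩, ⟨hp, N.mkQ x, ?_⟩, ?_⟩
  · ext a
    refine ⟨fun ha => (h a x (Submodule.mem_colon.mp ha x hx)).resolve_right hxN,
      fun ha => Submodule.mem_colon.mpr fun s hs => hs a ha⟩
  · have : colon (⊥ : Submodule R (M ⧸ N)) {N.mkQ x} = p := by
      ext a
      rw [Submodule.mem_colon_singleton, ← map_smul, Submodule.mem_bot, Submodule.mkQ_apply,
        Submodule.Quotient.mk_eq_zero]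
      exact ⟨fun ha => (h a x ha).resolve_right hxN, fun ha => hx a ha⟩
    rw [this, hp.radical]
  · rintro q ⟨hq, y, hy⟩ hpq
    obtain ⟨y, rfl⟩ := N.mkQ_surjective y
    refine le_antisymm (fun a ha => ?_) hpq
    have mem_iff (b : R) : b ∈ colon (⊥ : Submodule R (M ⧸ N)) {N.mkQ y} ↔ b • y ∈ N := by
      rw [Submodule.mem_colon_singleton, ← map_smul, Submodule.mem_bot, Submodule.mkQ_apply,
        Submodule.Quotient.mk_eq_zero]
    have hyN : y ∉ N := by
      intro hyN
      refine hq.ne_top ((Ideal.eq_top_iff_one q).mpr ?_)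
      rw [hy]
      exact Ideal.le_radical ((mem_iff 1).mpr (by simpa using hyN))
    rw [hy] at ha
    obtain ⟨k, hk⟩ := ha
    exact hp.mem_of_pow_mem k ((h _ y ((mem_iff _).mp hk)).resolve_right hyN)

theorem HasPFactorization.top : HasPFactorization (⊤ : Submodule R M) 0 :=
  ⟨0, fun _ => ⊤, Fin.elim0, ⟨rfl, rfl, fun i => i.elim0⟩, by simp⟩

theorem HasPFactorization.cons {p : Ideal R} {N K : Submodule R M} {S : Multiset (Ideal R)}
    (h : IsRegularPrimeExtension p N K) (hK : HasPFactorization K S) :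
    HasPFactorization N (p ::ₘ S) := by
  obtain ⟨n, F, P, ⟨hF, hlast, hstep⟩, rfl⟩ := hK
  refine ⟨n + 1, Fin.cons N F, Fin.cons p P, ⟨rfl, ?_, ?_⟩, ?_⟩
  · rw [← Fin.succ_last, Fin.cons_succ, hlast]
  · intro i
    refine Fin.cases ?_ (fun j => ?_) i
    · simpa [hF] using h
    · simpa [← Fin.succ_castSucc] using hstep j
  · simp [List.ofFn_succ]

/-- A submodule which is saturated off `p` and contains `p ^ n • ⊤` factors as a power of `p`. -/
theorem IsSaturatedOff.hasPFactorization {p : Ideal R} [p.IsPrime] :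
    ∀ (n : ℕ) {N : Submodule R M}, IsSaturatedOff p N → p ^ n • (⊤ : Submodule R M) ≤ N →
      ∃ r ≤ n, HasPFactorization N (Multiset.replicate r p)
  | 0, N, _, hn => by
    obtain rfl : N = ⊤ := by simpa using hn
    exact ⟨0, le_rfl, HasPFactorization.top⟩
  | n + 1, N, h, hn => by
    by_cases hN : primeResidual N p ≤ N
    · obtain rfl := eq_top_of_primeResidual_le hN hn
      exact ⟨0, Nat.zero_le _, HasPFactorization.top⟩
    · rw [pow_succ', Submodule.mul_smul, smul_le_iff_le_primeResidual] at hn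
      obtain ⟨r, hr, hfac⟩ := IsSaturatedOff.hasPFactorization n (isSaturatedOff_primeResidual h) hn
      refine ⟨r + 1, Nat.succ_le_succ hr, ?_⟩
      rw [Multiset.replicate_succ]
      exact HasPFactorization.cons (h.isRegularPrimeExtension hN) hfac

theorem HasPFactorization.isSaturatedOff_and_pow_smul_le {p : Ideal R} {N : Submodule R M} {n : ℕ}
    (h : HasPFactorization N (Multiset.replicate n p)) :
    IsSaturatedOff p N ∧ p ^ n • (⊤ : Submodule R M) ≤ N := by
  obtain ⟨m, F, P, ⟨rfl, hlast, hstep⟩, hP⟩ := h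
  obtain rfl : m = n := by simpa using congrArg Multiset.card hP
  have hPp (i : Fin m) : P i = p := by
    refine Multiset.eq_of_mem_replicate (n := m) ?_
    rw [← hP]
    simp
  have hext (i : Fin m) : IsPrimeExtension p (F i.castSucc) (F i.succ) := hPp i ▸ (hstep i).1.1
  have key (i : Fin (m + 1)) :
      IsSaturatedOff p (F i) ∧ p ^ (m - (i : ℕ)) • (⊤ : Submodule R M) ≤ F i := by
    induction i using Fin.reverseInduction with
    | last => simp [hlast, IsSaturatedOff]
    | cast i ih =>
      refine ⟨(hext i).isSaturatedOff ih.1, ?_⟩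
      have hi : m - (i.castSucc : ℕ) = (m - (i.succ : ℕ)) + 1 := by
        simp only [Fin.val_castSucc, Fin.val_succ]
        lia
      rw [hi, pow_succ', Submodule.mul_smul, smul_le_iff_le_primeResidual]
      exact ih.2.trans (hext i).le_primeResidual
  simpa using key 0

end Helpers

/-- If `P_M(N) = p^n` for a prime `p`, then for any submodule `K` of `M` the ideal
`(N : K)` has factorization `P_R((N : K)) = p^r` for some `r ≤ n`. -/
theorem stmt_12 {R : Type*} [CommRing R] [IsNoetherianRing R]
    {M : Type*} [AddCommGroup M] [Module R M] [Module.Finite R M]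
    (N : Submodule R M) (p : Ideal R) (hp : p.IsPrime) (n : ℕ)
    (hfac : HasPFactorization N (Multiset.replicate n p)) (K : Submodule R M) :
    ∃ r ≤ n, HasPFactorization (M := R) (N.colon K) (Multiset.replicate r p) := by
  obtain ⟨hsat, hpow⟩ := hfac.isSaturatedOff_and_pow_smul_le
  refine (isSaturatedOff_colon hsat (K : Set M)).hasPFactorization n ?_
  rw [Submodule.smul_le]
  intro a ha b _
  refine Submodule.mem_colon.mpr fun x _ => ?_
  rw [smul_assoc]
  exact hpow (Submodule.smul_mem_smul ha Submodule.mem_top)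
end

section
/- Let R be a commutative Noetherian ring, M a finitely generated R-module, N a proper submodule of M, and a = Ann_R(M/N) = (N : M). Then Ass_R(R/a) ⊆ Ass_R(M/N). -/
open Submodule

/-- For a proper submodule `N` of `M` and `a = Ann_R(M/N) = (N : M)`,
`Ass_R(R/a) ⊆ Ass_R(M/N)`. -/
theorem stmt_13 {R : Type*} [CommRing R] [IsNoetherianRing R]
    {M : Type*} [AddCommGroup M] [Module R M] [Module.Finite R M]
    (N : Submodule R M) (hN : N ≠ ⊤) (a : Ideal R) (ha : a = N.colon ⊤) :
    associatedPrimes R (R ⧸ (a : Submodule R R)) ⊆ associatedPrimes R (M ⧸ N) := by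
  intro p hp
  obtain ⟨hprime, y, hy⟩ := isAssociatedPrime_iff.mp hp
  obtain ⟨r, rfl⟩ := Submodule.mkQ_surjective _ y
  obtain ⟨s, hs⟩ := Module.Finite.fg_top (R := R) (M := M)
  have mem_p (x : R) : x ∈ p ↔ ∀ m : M, x • r • m ∈ N := by
    rw [hy, mem_colon_singleton, mem_bot, ← map_smul, mkQ_apply, Quotient.mk_eq_zero, ha,
      mem_colon]
    simp [mul_smul]
  have inf_le : s.inf (fun m ↦ N.colon {r • m}) ≤ p := by
    intro x hx
    rw [Submodule.mem_finsetInf] at hx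
    have hspan : span R (s : Set M) ≤ N.comap (LinearMap.lsmul R M (x * r)) :=
      span_le.mpr fun m hm ↦ by simpa [mem_colon_singleton, mul_smul] using hx m hm
    rw [hs] at hspan
    exact (mem_p x).mpr fun m ↦ by simpa [mul_smul] using hspan (mem_top (x := m))
  obtain ⟨m, -, hm⟩ := hprime.inf_le'.mp inf_le
  refine isAssociatedPrime_iff.mpr ⟨hprime, N.mkQ (r • m), le_antisymm (fun x hx ↦ ?_) ?_⟩
  · rw [mem_colon_singleton, mem_bot, ← map_smul, mkQ_apply, Quotient.mk_eq_zero]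
    exact (mem_p x).mp hx m
  · refine fun x hx ↦ hm (mem_colon_singleton.mpr ?_)
    rwa [mem_colon_singleton, mem_bot, ← map_smul, mkQ_apply, Quotient.mk_eq_zero] at hx
end

section
/- Let R be a commutative Noetherian ring, M a finitely generated R-module, N a proper submodule of M, and a = Ann_R(M/N) = (N : M). If every prime ideal in Ass_R(M/N) is isolated (i.e., every associated prime of M/N is a minimal element of Ass_R(M/N)), then Ass_R(R/a) = Ass_R(M/N). -/
open Submodule

theorem Submodule.annihilator_quotient_eq_colon_top {R M : Type*} [CommRing R] [AddCommGroup M]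
    [Module R M] (N : Submodule R M) : Module.annihilator R (M ⧸ N) = N.colon ⊤ := by
  ext r
  simp only [Module.mem_annihilator, Submodule.mem_colon, Set.top_eq_univ, Set.mem_univ,
    forall_true_left]
  refine ⟨fun h x => ?_, fun h y => ?_⟩
  · rw [← Submodule.Quotient.mk_eq_zero, Submodule.Quotient.mk_smul]
    exact h _
  · obtain ⟨x, rfl⟩ := N.mkQ_surjective y
    rw [← map_smul, Submodule.mkQ_apply, Submodule.Quotient.mk_eq_zero]
    exact h x

theorem associatedPrimes_quotient_annihilator_subset {R M : Type*} [CommRing R]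
    [IsNoetherianRing R] [AddCommGroup M] [Module R M] [Module.Finite R M] :
    associatedPrimes R (R ⧸ Module.annihilator R M) ⊆ associatedPrimes R M := by
  intro P hP
  rw [AssociatedPrimes.mem_iff, isAssociatedPrime_iff] at hP ⊢
  obtain ⟨hP, x, hx⟩ := hP
  obtain ⟨r, rfl⟩ := Ideal.Quotient.mk_surjective x
  have hmem (c : R) : c ∈ P ↔ ∀ m : M, c • r • m = 0 := by
    rw [hx, Submodule.mem_colon_singleton, Submodule.mem_bot, Algebra.smul_def,
      Ideal.Quotient.algebraMap_eq, ← map_mul, Ideal.Quotient.eq_zero_iff_mem,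
      Module.mem_annihilator]
    simp only [mul_smul]
  obtain ⟨s, hs⟩ := Module.Finite.fg_top (R := R) (M := M)
  have hle : s.inf (fun m => (⊥ : Submodule R M).colon {r • m}) ≤ P := by
    intro c hc
    rw [Submodule.mem_finsetInf] at hc
    rw [hmem]
    intro m
    have hm : m ∈ Submodule.span R (s : Set M) := hs ▸ Submodule.mem_top
    induction hm using Submodule.span_induction with
    | mem m hm => simpa using hc m hm
    | zero => simp
    | add m n _ _ hm hn => rw [smul_add, smul_add, hm, hn, add_zero]
    | smul b m _ hm => rw [smul_comm r b, smul_comm c b, hm, smul_zero]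
  obtain ⟨m, -, hm⟩ := (Ideal.IsPrime.inf_le' hP).mp hle
  refine ⟨hP, r • m, le_antisymm (fun c hc => ?_) hm⟩
  simpa using (hmem c).mp hc m

/-- For a proper submodule `N` of `M` and `a = Ann_R(M/N) = (N : M)`: if every prime
in `Ass_R(M/N)` is isolated (minimal in `Ass_R(M/N)`), then `Ass_R(R/a) = Ass_R(M/N)`. -/
theorem stmt_14 {R : Type*} [CommRing R] [IsNoetherianRing R]
    {M : Type*} [AddCommGroup M] [Module R M] [Module.Finite R M]
    (N : Submodule R M) (hN : N ≠ ⊤) (a : Ideal R) (ha : a = N.colon ⊤)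
    (hiso : ∀ q ∈ associatedPrimes R (M ⧸ N),
      ∀ q' ∈ associatedPrimes R (M ⧸ N), q' ≤ q → q' = q) :
    associatedPrimes R (R ⧸ (a : Submodule R R)) = associatedPrimes R (M ⧸ N) := by
  rw [← N.annihilator_quotient_eq_colon_top] at ha
  subst ha
  refine subset_antisymm associatedPrimes_quotient_annihilator_subset fun Q hQ => ?_
  have hle : Module.annihilator R (M ⧸ N) ≤ Q := by
    simpa only [Submodule.annihilator_top] using IsAssociatedPrime.annihilator_le hQ
  have := hQ.isPrime
  obtain ⟨q, hq, hqQ⟩ := Ideal.exists_minimalPrimes_le hle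
  obtain rfl := hiso Q hQ q
    (Module.associatedPrimes.minimalPrimes_annihilator_subset_associatedPrimes R _ hq) hqQ
  apply Module.associatedPrimes.minimalPrimes_annihilator_subset_associatedPrimes R
  rwa [Ideal.annihilator_quotient]
end
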